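/- Let d ≥ 1, let s > 0 be a real number, and let W be a d×d real nilpotent matrix (so that W is the weighted adjacency matrix of a DAG). Then the gradient of h_ldet at W, namely the matrix ((s·I − W)⁻¹)ᵀ, is nonzero. In particular, the acyclicity function h_ldet(W) = d·log(s) − log det(s·I − W) has no stationary points at DAGs. -/

import Mathlib

open Matrix

theorem stmt8 (d : ℕ) (hd : 1 ≤ d) (s : ℝ) (hs : 0 < s)
    (W : Matrix (Fin d) (Fin d) ℝ) (hnil : W ^ d = 0) :
    ((s • (1 : Matrix (Fin d) (Fin d) ℝ) - W)⁻¹)ᵀ ≠ 0 := by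
  haveI : Nonempty (Fin d) := ⟨⟨0, hd⟩⟩
  have hW : IsNilpotent (-W) := IsNilpotent.neg ⟨d, hnil⟩
  have hs1 : IsUnit (s • (1 : Matrix (Fin d) (Fin d) ℝ)) := by
    rw [← Algebra.algebraMap_eq_smul_one]
    exact (IsUnit.mk0 s hs.ne').map (algebraMap ℝ (Matrix (Fin d) (Fin d) ℝ))
  have hcomm : Commute (-W) (s • (1 : Matrix (Fin d) (Fin d) ℝ)) :=
    (Commute.one_right (-W)).smul_right s
  have hu : IsUnit (s • (1 : Matrix (Fin d) (Fin d) ℝ) - W) := by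
    rw [sub_eq_add_neg]
    exact hW.isUnit_add_left_of_commute hs1 hcomm
  intro h
  have h0 : (s • (1 : Matrix (Fin d) (Fin d) ℝ) - W)⁻¹ = 0 :=
    Matrix.transpose_eq_zero.mp h
  have h1 := Matrix.mul_nonsing_inv _ ((Matrix.isUnit_iff_isUnit_det _).mp hu)
  rw [h0, mul_zero] at h1
  exact zero_ne_one h1
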